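/- For every complex symmetric matrix A ∈ ℂ^{n×n} (i.e., A = Aᵀ), there exist a unitary matrix Q ∈ ℂ^{n×n} (QQᴴ = I) and real numbers σ₁ ≥ σ₂ ≥ … ≥ σₙ ≥ 0 such that A = Q · diag(σ₁,…,σₙ) · Qᵀ (the Takagi factorization). -/

import Mathlib

open Matrix

section Coneigen

variable {E : Type*} [NormedAddCommGroup E] [InnerProductSpace ℂ E] [FiniteDimensional ℂ E]

/-- A symmetric antilinear operator on a nontrivial finite-dimensional space has a unit vector `v`
with `T v = σ • v` for some real `σ ≥ 0`. -/
theorem exists_unit_coneigenvector [Nontrivial E] (T : E →ₛₗ[starRingEnd ℂ] E)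
    (hT : ∀ x y, inner ℂ x (T y) = inner ℂ y (T x)) :
    ∃ (v : E) (σ : ℝ), ‖v‖ = 1 ∧ 0 ≤ σ ∧ T v = (σ : ℂ) • v := by
  let : InnerProductSpace ℝ E := InnerProductSpace.complexToReal
  have : FiniteDimensional ℝ E := FiniteDimensional.complexToReal E
  let S : E →ₗ[ℝ] E :=
    { toFun := T
      map_add' := map_add T
      map_smul' := fun r x => by
        simp only [← Complex.coe_smul, LinearMap.map_smulₛₗ, Complex.conj_ofReal, RingHom.id_apply] }
  have hS : S.IsSymmetric := fun x y => by
    change (inner ℂ (T x) y).re = (inner ℂ x (T y)).re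
    rw [hT x y, ← inner_conj_symm, Complex.conj_re]
  obtain ⟨w, hw⟩ := hS.hasEigenvalue_iSup_of_finiteDimensional.exists_hasEigenvector
  generalize (⨆ x : { x : E // x ≠ 0 }, _ : ℝ) = μ at hw
  have hw0 : w ≠ 0 := hw.2
  have hTw : T w = (μ : ℂ) • w := by
    rw [Complex.coe_smul]
    exact hw.apply_eq_smul
  have hn : ‖w‖ ≠ 0 := norm_ne_zero_iff.mpr hw0
  rcases le_total 0 μ with h | h
  · refine ⟨((‖w‖⁻¹ : ℝ) : ℂ) • w, μ, ?_, h, ?_⟩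
    · rw [norm_smul, Complex.norm_real, norm_inv, norm_norm, inv_mul_cancel₀ hn]
    · rw [LinearMap.map_smulₛₗ, hTw, Complex.conj_ofReal, smul_comm]
  · refine ⟨(((‖w‖⁻¹ : ℝ) : ℂ) * Complex.I) • w, -μ, ?_, neg_nonneg.mpr h, ?_⟩
    · rw [norm_smul, norm_mul, Complex.norm_I, mul_one, Complex.norm_real, norm_inv, norm_norm,
        inv_mul_cancel₀ hn]
    · rw [LinearMap.map_smulₛₗ, hTw, map_mul, Complex.conj_ofReal, Complex.conj_I, smul_smul,
        smul_smul]
      congr 1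
      push_cast
      ring

end Coneigen

/-- A symmetric antilinear operator on a finite-dimensional space has an orthonormal family of
`finrank ℂ E` vectors with `T (v i) = σ i • v i` and `σ i ≥ 0`. -/
theorem exists_orthonormal_coneigenvectors {n : ℕ} {E : Type*} [NormedAddCommGroup E]
    [InnerProductSpace ℂ E] [FiniteDimensional ℂ E] (hE : Module.finrank ℂ E = n)
    (T : E →ₛₗ[starRingEnd ℂ] E) (hT : ∀ x y, inner ℂ x (T y) = inner ℂ y (T x)) :
    ∃ (v : Fin n → E) (σ : Fin n → ℝ), Orthonormal ℂ v ∧ (∀ i, 0 ≤ σ i) ∧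
      ∀ i, T (v i) = (σ i : ℂ) • v i := by
  induction n generalizing E with
  | zero => exact ⟨Fin.elim0, Fin.elim0, ⟨fun i => i.elim0, fun i => i.elim0⟩,
      fun i => i.elim0, fun i => i.elim0⟩
  | succ n ih =>
    have : Nontrivial E := Module.nontrivial_of_finrank_pos (R := ℂ) (by omega)
    have : Fact (Module.finrank ℂ E = n + 1) := ⟨hE⟩
    obtain ⟨v, σ, hv, hσ, hTv⟩ := exists_unit_coneigenvector T hT
    have hv0 : v ≠ 0 := by
      rintro rfl
      simp at hv
    have hinv : ∀ x : (ℂ ∙ v)ᗮ, T x ∈ (ℂ ∙ v)ᗮ := fun x => by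
      rw [Submodule.mem_orthogonal_singleton_iff_inner_right, hT, hTv, inner_smul_right,
        Submodule.mem_orthogonal_singleton_iff_inner_left.mp x.2, mul_zero]
    let S : (ℂ ∙ v)ᗮ →ₛₗ[starRingEnd ℂ] (ℂ ∙ v)ᗮ :=
      (T.comp (ℂ ∙ v)ᗮ.subtype).codRestrict _ hinv
    obtain ⟨w, τ, hw, hτ, hSw⟩ := ih (Submodule.finrank_orthogonal_span_singleton hv0) S
      fun x y => hT x y
    refine ⟨Matrix.vecCons v fun i => (w i : E), Matrix.vecCons σ τ, ?_, ?_, ?_⟩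
    · rw [orthonormal_vecCons_iff]
      exact ⟨hv, fun i => Submodule.mem_orthogonal_singleton_iff_inner_right.mp (w i).2,
        hw.comp_linearIsometry (ℂ ∙ v)ᗮ.subtypeₗᵢ⟩
    · exact Fin.cases hσ hτ
    · exact Fin.cases hTv fun i => congrArg Subtype.val (hSw i)

/-- The antilinear operator `x ↦ A * conj x` on `EuclideanSpace ℂ ι`. -/
noncomputable def Matrix.mulVecConj {ι : Type*} [Fintype ι] (A : Matrix ι ι ℂ) :
    EuclideanSpace ℂ ι →ₛₗ[starRingEnd ℂ] EuclideanSpace ℂ ι where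
  toFun x := WithLp.toLp 2 (A *ᵥ star x.ofLp)
  map_add' x y := by simp [mulVec_add]
  map_smul' c x := by simp [mulVec_smul]

theorem Matrix.inner_mulVecConj_comm {ι : Type*} [Fintype ι] {A : Matrix ι ι ℂ} (hA : A = Aᵀ)
    (x y : EuclideanSpace ℂ ι) :
    inner ℂ x (A.mulVecConj y) = inner ℂ y (A.mulVecConj x) := by
  simp only [EuclideanSpace.inner_eq_star_dotProduct, mulVecConj, LinearMap.coe_mk, AddHom.coe_mk]
  rw [dotProduct_comm, dotProduct_mulVec, ← mulVec_transpose, ← hA]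

/-- Takagi factorization: every complex symmetric matrix can be written as
`Q * diagonal σ * Qᵀ` with `Q` unitary and the `σ k` nonnegative and decreasing. -/
theorem takagi_factorization {n : ℕ} (A : Matrix (Fin n) (Fin n) ℂ) (hA : A = Aᵀ) :
    ∃ (Q : Matrix (Fin n) (Fin n) ℂ) (σ : Fin n → ℝ),
      Q * Qᴴ = 1 ∧ Antitone σ ∧ (∀ k, 0 ≤ σ k) ∧
      A = Q * Matrix.diagonal (fun k => (σ k : ℂ)) * Qᵀ := by
  obtain ⟨v, σ, hv, hσ, hAv⟩ := exists_orthonormal_coneigenvectors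
    (finrank_euclideanSpace_fin (𝕜 := ℂ) (n := n)) A.mulVecConj (inner_mulVecConj_comm hA)
  let e := Tuple.sort fun k => -σ k
  have he : Antitone fun k => σ (e k) := fun i j hij =>
    neg_le_neg_iff.mp (Tuple.monotone_sort (fun k => -σ k) hij)
  let Q : Matrix (Fin n) (Fin n) ℂ := Matrix.of fun i j => v (e j) i
  have hQ : Q * Qᴴ = 1 := by
    rw [mul_eq_one_comm]
    ext i j
    have h := orthonormal_iff_ite.mp (hv.comp e e.injective) i j
    rw [EuclideanSpace.inner_eq_star_dotProduct, dotProduct_comm] at h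
    rw [one_apply, ← h]
    rfl
  have hAQ : A * Qᴴᵀ = Q * diagonal fun k => (σ (e k) : ℂ) := by
    ext i j
    have h := congrArg (fun x : EuclideanSpace ℂ (Fin n) => x i) (hAv (e j))
    rw [mul_diagonal, mul_comm]
    exact h
  refine ⟨Q, fun k => σ (e k), hQ, he, fun k => hσ _, ?_⟩
  rw [← hAQ, Matrix.mul_assoc, ← transpose_mul, hQ, transpose_one, Matrix.mul_one]
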